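/- Let a, b be natural numbers. For every path w ∈ D_{a,b}, A(w) ≥ a + b²/2, and this minimum is attained (for example by the path consisting of a up-down pairs followed by b up steps). -/

import Mathlib

noncomputable section

open Finset

/-- Height of the path `w` (of length `L`, up = `true`, down = `false`) after `i` steps. -/
def height {L : ℕ} (w : Fin L → Bool) (i : ℕ) : ℤ :=
  ∑ j ∈ Finset.univ.filter (fun j : Fin L => (j : ℕ) < i),
    (if w j then (1 : ℤ) else -1)

/-- `DyckSet a b`: the set `D_{a,b}` of paths of length `2a+b` with `a+b` up steps whose
heights stay nonnegative. -/
def DyckSet (a b : ℕ) : Finset (Fin (2 * a + b) → Bool) :=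
  Finset.univ.filter (fun w =>
    (Finset.univ.filter (fun j => w j = true)).card = a + b ∧
      ∀ i ≤ 2 * a + b, 0 ≤ height w i)

/-- The area `A(w)` between the path `w` and the x-axis. -/
def area {L : ℕ} (w : Fin L → Bool) : ℝ :=
  (∑ i ∈ Finset.range L, ((height w i + height w (i + 1) : ℤ) : ℝ)) / 2

/-- The weighted path sum `M_{2a+b,b}(t) = Σ_{w ∈ D_{a,b}} t^{A(w)}`. -/
def M (a b : ℕ) (t : ℝ) : ℝ := ∑ w ∈ DyckSet a b, t ^ area w

/-- `M_{ℓ,m}(t)` for `ℓ ≥ m` with `ℓ - m` even. -/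
def Mlm (ℓ m : ℕ) (t : ℝ) : ℝ := M ((ℓ - m) / 2) m t

/-- `P k`: the number of partitions of `k`. -/
def P (k : ℕ) : ℕ := Fintype.card (Nat.Partition k)

/-- `C(t) = Σ_{k=0}^∞ P(k) t^{-2k}`. -/
def C (t : ℝ) : ℝ := ∑' k : ℕ, (P k : ℝ) * t ^ (-(2 : ℝ) * k)

theorem height_zero {L : ℕ} (w : Fin L → Bool) : height w 0 = 0 := by
  simp [height]

theorem height_succ {L : ℕ} (w : Fin L → Bool) {i : ℕ} (hi : i < L) :
    height w (i + 1) = height w i + if w ⟨i, hi⟩ then 1 else -1 := by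
  have h : Finset.univ.filter (fun j : Fin L => (j : ℕ) < i + 1)
      = insert ⟨i, hi⟩ (Finset.univ.filter (fun j : Fin L => (j : ℕ) < i)) := by
    ext j
    simp only [Finset.mem_filter, Finset.mem_univ, true_and, Finset.mem_insert, Fin.ext_iff]
    omega
  unfold height
  rw [h, Finset.sum_insert (by simp), add_comm]

theorem height_length {L : ℕ} (w : Fin L → Bool) :
    height w L = 2 * (Finset.univ.filter (fun j => w j = true)).card - L := by
  have h : ∀ j : Fin L, (if w j then (1 : ℤ) else -1) = 2 * (if w j then 1 else 0) - 1 := by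
    intro j
    split_ifs <;> norm_num
  simp only [height, h, Finset.sum_sub_distrib, ← Finset.mul_sum, Finset.sum_boole]
  simp

/-- Twice the area below a nonnegative path up to time `n` is at least `n - h + h ^ 2`,
where `h` is the height at time `n`. -/
theorem le_sum_height {L : ℕ} (w : Fin L → Bool) (hw : ∀ i ≤ L, 0 ≤ height w i) :
    ∀ n ≤ L, (n : ℤ) - height w n + height w n ^ 2
      ≤ ∑ i ∈ Finset.range n, (height w i + height w (i + 1)) := by
  intro n
  induction n with
  | zero => simp [height_zero]
  | succ n ih =>
    intro hn
    have hS := ih (by omega)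
    have hnonneg := hw (n + 1) hn
    have hstep := height_succ w (i := n) (by omega)
    rw [Finset.sum_range_succ]
    push_cast
    split_ifs at hstep <;> rw [hstep] at hnonneg ⊢ <;> nlinarith

/-- The path of `a` up-down pairs followed by `b` up steps. -/
abbrev minimalPath (a b : ℕ) : Fin (2 * a + b) → Bool :=
  fun j => decide ((j : ℕ) % 2 = 0 ∨ 2 * a ≤ (j : ℕ))

theorem height_minimalPath (a b : ℕ) :
    ∀ i ≤ 2 * a + b,
      height (minimalPath a b) i = if i ≤ 2 * a then (i : ℤ) % 2 else (i : ℤ) - 2 * a := by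
  intro i
  induction i with
  | zero => simp [height_zero]
  | succ i ih =>
    intro hi
    rw [height_succ _ (by omega), ih (by omega)]
    simp only [decide_eq_true_eq]
    push_cast
    split_ifs <;> omega

theorem height_minimalPath_length (a b : ℕ) :
    height (minimalPath a b) (2 * a + b) = b := by
  rw [height_minimalPath a b _ le_rfl]
  push_cast
  split_ifs <;> omega

theorem minimalPath_mem_DyckSet (a b : ℕ) : minimalPath a b ∈ DyckSet a b := by
  simp only [DyckSet, Finset.mem_filter, Finset.mem_univ, true_and]
  constructor
  · have h := height_length (minimalPath a b)
    rw [height_minimalPath_length] at h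
    push_cast at h
    omega
  · intro i hi
    rw [height_minimalPath a b i hi]
    split_ifs <;> omega

theorem sum_height_minimalPath (a b : ℕ) :
    ∀ n ≤ 2 * a + b,
      ∑ i ∈ Finset.range n, (height (minimalPath a b) i + height (minimalPath a b) (i + 1))
        = (n : ℤ) - height (minimalPath a b) n + height (minimalPath a b) n ^ 2 := by
  intro n
  induction n with
  | zero => simp [height_zero]
  | succ n ih =>
    intro hn
    rw [Finset.sum_range_succ, ih (by omega), height_succ _ (by omega)]
    push_cast
    split_ifs with hup
    · ring
    · have h : height (minimalPath a b) n = 1 := by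
        simp only [decide_eq_true_eq, not_or] at hup
        rw [height_minimalPath a b n (by omega), if_pos (by omega)]
        omega
      rw [h]
      ring

theorem area_eq_intCast_div {L : ℕ} (w : Fin L → Bool) :
    area w = ((∑ i ∈ Finset.range L, (height w i + height w (i + 1)) : ℤ) : ℝ) / 2 := by
  rw [area, Int.cast_sum]

/-- Minimal area: every `w ∈ D_{a,b}` has `A(w) ≥ a + b²/2`, and the minimum is attained
by the path consisting of `a` up-down pairs followed by `b` up steps. -/
theorem stmt_4 (a b : ℕ) :
    (∀ w ∈ DyckSet a b, (a : ℝ) + (b : ℝ) ^ 2 / 2 ≤ area w) ∧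
    (fun j : Fin (2 * a + b) => decide ((j : ℕ) % 2 = 0 ∨ 2 * a ≤ (j : ℕ))) ∈ DyckSet a b ∧
    area (fun j : Fin (2 * a + b) => decide ((j : ℕ) % 2 = 0 ∨ 2 * a ≤ (j : ℕ)))
      = (a : ℝ) + (b : ℝ) ^ 2 / 2 := by
  refine ⟨fun w hw => ?_, minimalPath_mem_DyckSet a b, ?_⟩
  · simp only [DyckSet, Finset.mem_filter, Finset.mem_univ, true_and] at hw
    obtain ⟨hcard, hnonneg⟩ := hw
    have hend : height w (2 * a + b) = b := by
      rw [height_length, hcard]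
      push_cast
      ring
    have h := le_sum_height w hnonneg _ le_rfl
    rw [hend] at h
    have hreal := (Int.cast_le (R := ℝ)).mpr h
    rw [area_eq_intCast_div]
    push_cast at hreal ⊢
    linarith
  · rw [area_eq_intCast_div, sum_height_minimalPath a b _ le_rfl, height_minimalPath_length]
    push_cast
    ring
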